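/- arXiv:2406.10947 — 2 statements merged into one kernel-verified Lean document; each statement's English description precedes it below -/
import Mathlib

section
/- Let μ be the pre-Lie multiplication C08 on ℂ²: e1·e1 = e1, e1·e2 = 2 e2, e2·e1 = (1/2) e1 + e2, e2·e2 = e2. A linear bijection φ : ℂ² → ℂ² satisfies φ(μ(x,y)) = μ(φ(x),φ(y)) for all x,y if and only if either φ(e1) = e1 and φ(e2) = e2, or φ(e1) = −e1 + 4 e2 and φ(e2) = e2. -/
open scoped BigOperators

/-- The underlying vector space `ℂ²`. -/
abbrev V2 : Type := Fin 2 → ℂ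

/-- The first standard basis vector of `ℂ²`. -/
noncomputable def e1 : V2 := ![1, 0]

/-- The second standard basis vector of `ℂ²`. -/
noncomputable def e2 : V2 := ![0, 1]

/-- The bilinear multiplication on `ℂ²` with multiplication table `f`,
i.e. the product of the `i`-th and `j`-th basis vectors is `f i j`. -/
noncomputable def bil (f : Fin 2 → Fin 2 → V2) : V2 →ₗ[ℂ] V2 →ₗ[ℂ] V2 :=
  LinearMap.mk₂ ℂ (fun x y => ∑ i : Fin 2, ∑ j : Fin 2, (x i * y j) • f i j)
    (fun x x' y => by
      simp only [Pi.add_apply, add_mul, add_smul, Finset.sum_add_distrib])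
    (fun c x y => by
      simp only [Pi.smul_apply, smul_eq_mul, Finset.smul_sum, smul_smul]
      refine Finset.sum_congr rfl fun i _ => Finset.sum_congr rfl fun j _ => ?_
      congr 1
      ring)
    (fun x y y' => by
      simp only [Pi.add_apply, mul_add, add_smul, Finset.sum_add_distrib])
    (fun c x y => by
      simp only [Pi.smul_apply, smul_eq_mul, Finset.smul_sum, smul_smul]
      refine Finset.sum_congr rfl fun i _ => Finset.sum_congr rfl fun j _ => ?_
      congr 1
      ring)

/-- A bilinear map is a pre-Lie multiplication if it satisfies the (right)
pre-Lie identity. -/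
def IsPreLie {V : Type*} [AddCommGroup V] [Module ℂ V]
    (μ : V →ₗ[ℂ] V →ₗ[ℂ] V) : Prop :=
  ∀ x y z : V, μ (μ x y) z - μ x (μ y z) = μ (μ y x) z - μ y (μ x z)

/-- `(V, μ, ν)` is a compatible pre-Lie algebra: `μ`, `ν` and `μ + ν` are all
pre-Lie multiplications. -/
def IsCompatPreLie {V : Type*} [AddCommGroup V] [Module ℂ V]
    (μ ν : V →ₗ[ℂ] V →ₗ[ℂ] V) : Prop :=
  IsPreLie μ ∧ IsPreLie ν ∧ IsPreLie (μ + ν)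

/-- Isomorphism of the two-multiplication algebras `(ℂ², μ, ν)` and `(ℂ², μ', ν')`. -/
def CompatIso (μ ν μ' ν' : V2 →ₗ[ℂ] V2 →ₗ[ℂ] V2) : Prop :=
  ∃ φ : V2 ≃ₗ[ℂ] V2, (∀ x y : V2, φ (μ x y) = μ' (φ x) (φ y)) ∧
    (∀ x y : V2, φ (ν x y) = ν' (φ x) (φ y))

/-- `C01 : e1·e1 = e1 + e2, e2·e1 = e2`. -/
noncomputable def C01 : V2 →ₗ[ℂ] V2 →ₗ[ℂ] V2 := bil ![![e1 + e2, 0], ![e2, 0]]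

/-- `C02 : e1·e1 = e1 + e2, e1·e2 = e2`. -/
noncomputable def C02 : V2 →ₗ[ℂ] V2 →ₗ[ℂ] V2 := bil ![![e1 + e2, e2], ![0, 0]]

/-- `C03 : e1·e1 = e2`. -/
noncomputable def C03 : V2 →ₗ[ℂ] V2 →ₗ[ℂ] V2 := bil ![![e2, 0], ![0, 0]]

/-- `C04 : e2·e1 = e1`. -/
noncomputable def C04 : V2 →ₗ[ℂ] V2 →ₗ[ℂ] V2 := bil ![![0, 0], ![e1, 0]]

/-- `C05^α : e1·e1 = e1, e1·e2 = α e2`. -/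
noncomputable def C05 (α : ℂ) : V2 →ₗ[ℂ] V2 →ₗ[ℂ] V2 := bil ![![e1, α • e2], ![0, 0]]

/-- `C06^α : e1·e1 = e1, e1·e2 = α e2, e2·e1 = e2`. -/
noncomputable def C06 (α : ℂ) : V2 →ₗ[ℂ] V2 →ₗ[ℂ] V2 := bil ![![e1, α • e2], ![e2, 0]]

/-- `C07 : e1·e1 = e1, e2·e2 = e2`. -/
noncomputable def C07 : V2 →ₗ[ℂ] V2 →ₗ[ℂ] V2 := bil ![![e1, 0], ![0, e2]]

/-- `C08 : e1·e1 = e1, e1·e2 = 2 e2, e2·e1 = (1/2) e1 + e2, e2·e2 = e2`. -/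
noncomputable def C08 : V2 →ₗ[ℂ] V2 →ₗ[ℂ] V2 :=
  bil ![![e1, (2 : ℂ) • e2], ![(1 / 2 : ℂ) • e1 + e2, e2]]

/-- The second multiplication of `C09^{α,β}`: `e1∗e1 = α e1, e1∗e2 = β e2, e2∗e1 = α e2`. -/
noncomputable def C09s (α β : ℂ) : V2 →ₗ[ℂ] V2 →ₗ[ℂ] V2 :=
  bil ![![α • e1, β • e2], ![α • e2, 0]]

/-- The second multiplication of `C10^{α,β}`: `e1∗e1 = α e1 + β e2, e2∗e1 = α e2`. -/
noncomputable def C10s (α β : ℂ) : V2 →ₗ[ℂ] V2 →ₗ[ℂ] V2 :=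
  bil ![![α • e1 + β • e2, 0], ![α • e2, 0]]

/-- The second multiplication of `C11^{α,β}`: `e1∗e1 = α e1, e1∗e2 = β e2`. -/
noncomputable def C11s (α β : ℂ) : V2 →ₗ[ℂ] V2 →ₗ[ℂ] V2 :=
  bil ![![α • e1, β • e2], ![0, 0]]

/-- The second multiplication of `C12^{α,β}`: `e1∗e1 = α e1 + β e2, e1∗e2 = α e2`. -/
noncomputable def C12s (α β : ℂ) : V2 →ₗ[ℂ] V2 →ₗ[ℂ] V2 :=
  bil ![![α • e1 + β • e2, α • e2], ![0, 0]]

/-- The second multiplication of `C13^α`: `e1∗e1 = α e1, e1∗e2 = e2, e2∗e1 = α e2`. -/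
noncomputable def C13s (α : ℂ) : V2 →ₗ[ℂ] V2 →ₗ[ℂ] V2 :=
  bil ![![α • e1, e2], ![α • e2, 0]]

/-- The second multiplication of `C14^α`: `e1∗e1 = e1 + α e2, e2∗e1 = e2`. -/
noncomputable def C14s (α : ℂ) : V2 →ₗ[ℂ] V2 →ₗ[ℂ] V2 :=
  bil ![![e1 + α • e2, 0], ![e2, 0]]

/-- The second multiplication of `C15^α`: `e1∗e1 = α e2`. -/
noncomputable def C15s (α : ℂ) : V2 →ₗ[ℂ] V2 →ₗ[ℂ] V2 :=
  bil ![![α • e2, 0], ![0, 0]]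

/-- The second multiplication of `C16^α`: `e1∗e1 = e1, e1∗e2 = α e2`. -/
noncomputable def C16s (α : ℂ) : V2 →ₗ[ℂ] V2 →ₗ[ℂ] V2 :=
  bil ![![e1, α • e2], ![0, 0]]

/-- The second multiplication of `C17^α`: `e1∗e1 = e1 + α e2, e1∗e2 = e2`. -/
noncomputable def C17s (α : ℂ) : V2 →ₗ[ℂ] V2 →ₗ[ℂ] V2 :=
  bil ![![e1 + α • e2, e2], ![0, 0]]

/-- The second multiplication of `C18^α`: `e1∗e1 = α e2, e1∗e2 = e1, e2∗e1 = e1, e2∗e2 = e2`. -/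
noncomputable def C18s (α : ℂ) : V2 →ₗ[ℂ] V2 →ₗ[ℂ] V2 :=
  bil ![![α • e2, e1], ![e1, e2]]

/-- The second multiplication of `C19^α`: `e1∗e1 = α e2, e2∗e1 = e1, e2∗e2 = 2 e2`. -/
noncomputable def C19s (α : ℂ) : V2 →ₗ[ℂ] V2 →ₗ[ℂ] V2 :=
  bil ![![α • e2, 0], ![e1, (2 : ℂ) • e2]]

/-- The second multiplication of `C20^{α,β}`: `e2∗e1 = α e1, e2∗e2 = e1 + β e2`. -/
noncomputable def C20s (α β : ℂ) : V2 →ₗ[ℂ] V2 →ₗ[ℂ] V2 :=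
  bil ![![0, 0], ![α • e1, e1 + β • e2]]

/-- The second multiplication of `C21^{α,β}`: `e2∗e1 = α e1, e2∗e2 = β e2`. -/
noncomputable def C21s (α β : ℂ) : V2 →ₗ[ℂ] V2 →ₗ[ℂ] V2 :=
  bil ![![0, 0], ![α • e1, β • e2]]

/-- The second multiplication of `C22^{α,β}`: `e1∗e2 = α e1, e2∗e1 = β e1, e2∗e2 = e1 + α e2`. -/
noncomputable def C22s (α β : ℂ) : V2 →ₗ[ℂ] V2 →ₗ[ℂ] V2 :=
  bil ![![0, α • e1], ![β • e1, e1 + α • e2]]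

/-- The second multiplication of `C23^{α,β}`: `e1∗e2 = α e1, e2∗e1 = β e1, e2∗e2 = α e2`. -/
noncomputable def C23s (α β : ℂ) : V2 →ₗ[ℂ] V2 →ₗ[ℂ] V2 :=
  bil ![![0, α • e1], ![β • e1, α • e2]]

/-- The second multiplication of `C24^{α,β,γ}`: `e1∗e1 = β e1 + e2, e1∗e2 = γ e2`. -/
noncomputable def C24s (β γ : ℂ) : V2 →ₗ[ℂ] V2 →ₗ[ℂ] V2 :=
  bil ![![β • e1 + e2, γ • e2], ![0, 0]]

/-- The second multiplication of `C25^{α,β,γ}`: `e1∗e1 = β e1, e1∗e2 = γ e2`. -/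
noncomputable def C25s (β γ : ℂ) : V2 →ₗ[ℂ] V2 →ₗ[ℂ] V2 :=
  bil ![![β • e1, γ • e2], ![0, 0]]

/-- The second multiplication of `C29^α`: `e1∗e1 = α e1, e2∗e2 = e2`. -/
noncomputable def C29s (α : ℂ) : V2 →ₗ[ℂ] V2 →ₗ[ℂ] V2 :=
  bil ![![α • e1, 0], ![0, e2]]

/-- The second multiplication of `C30^{α,β}`:
`e1∗e1 = α e1 + β e2, e1∗e2 = e1, e2∗e1 = e1, e2∗e2 = e2`. -/
noncomputable def C30s (α β : ℂ) : V2 →ₗ[ℂ] V2 →ₗ[ℂ] V2 :=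
  bil ![![α • e1 + β • e2, e1], ![e1, e2]]

/-- The second multiplication of `C31^{α,β,γ}`:
`e1∗e1 = β e1 + e2, e1∗e2 = γ e2, e2∗e1 = β e2`. -/
noncomputable def C31s (β γ : ℂ) : V2 →ₗ[ℂ] V2 →ₗ[ℂ] V2 :=
  bil ![![β • e1 + e2, γ • e2], ![β • e2, 0]]

/-- The second multiplication of `C32^{α,β,γ}`:
`e1∗e1 = β e1, e1∗e2 = γ e2, e2∗e1 = β e2`. -/
noncomputable def C32s (β γ : ℂ) : V2 →ₗ[ℂ] V2 →ₗ[ℂ] V2 :=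
  bil ![![β • e1, γ • e2], ![β • e2, 0]]

/-- The second multiplication of `C34^{α,β}`:
`e1∗e1 = α e1, e1∗e2 = α e2, e2∗e1 = α e2, e2∗e2 = e1 + β e2`. -/
noncomputable def C34s (α β : ℂ) : V2 →ₗ[ℂ] V2 →ₗ[ℂ] V2 :=
  bil ![![α • e1, α • e2], ![α • e2, e1 + β • e2]]

/-- The second multiplication of `C35^α`:
`e1∗e1 = α e1, e1∗e2 = α e2, e2∗e1 = α e2, e2∗e2 = e2`. -/
noncomputable def C35s (α : ℂ) : V2 →ₗ[ℂ] V2 →ₗ[ℂ] V2 :=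
  bil ![![α • e1, α • e2], ![α • e2, e2]]

/-- The second multiplication of `C38^{α,β,γ}`:
`e1∗e1 = (γ+β−α) e1 − β e2, e1∗e2 = α e1 + β e2, e2∗e1 = α e1 + β e2, e2∗e2 = −α e1 + γ e2`. -/
noncomputable def C38s (α β γ : ℂ) : V2 →ₗ[ℂ] V2 →ₗ[ℂ] V2 :=
  bil ![![(γ + β - α) • e1 - β • e2, α • e1 + β • e2],
        ![α • e1 + β • e2, (-α) • e1 + γ • e2]]

/-- The second multiplication of `C39^{α,β}`: `e1∗e1 = α e1, e2∗e2 = β e2`. -/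
noncomputable def C39s (α β : ℂ) : V2 →ₗ[ℂ] V2 →ₗ[ℂ] V2 :=
  bil ![![α • e1, 0], ![0, β • e2]]

/-- The second multiplication of `C40^{α,β,γ}`:
`e1∗e1 = α e1 + β e2, e1∗e2 = 2α e2, e2∗e1 = γ e1 + α e2, e2∗e2 = 2γ e2`. -/
noncomputable def C40s (α β γ : ℂ) : V2 →ₗ[ℂ] V2 →ₗ[ℂ] V2 :=
  bil ![![α • e1 + β • e2, (2 * α) • e2], ![γ • e1 + α • e2, (2 * γ) • e2]]

/-- The second multiplication of `C41^{α,β}`: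
`e1∗e1 = α e1, e1∗e2 = β e1 + 2α e2, e2∗e1 = (2β + α/2) e1 + α e2,
e2∗e2 = (β/2) e1 + (α+β) e2`. -/
noncomputable def C41s (α β : ℂ) : V2 →ₗ[ℂ] V2 →ₗ[ℂ] V2 :=
  bil ![![α • e1, β • e1 + (2 * α) • e2],
        ![(2 * β + α / 2) • e1 + α • e2, (β / 2) • e1 + (α + β) • e2]]

theorem C08_apply_zero (x y : V2) : C08 x y 0 = (x 0 + x 1 / 2) * y 0 := by
  simp [C08, bil, e1, e2, Fin.sum_univ_two]
  ring

theorem C08_apply_one (x y : V2) : C08 x y 1 = (2 * x 0 + x 1) * y 1 + x 1 * y 0 := by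
  simp [C08, bil, e1, e2, Fin.sum_univ_two]
  ring

theorem C08_e1_e1 : C08 e1 e1 = e1 := by
  simp [C08, bil, e1, Fin.sum_univ_two]

theorem C08_e1_e2 : C08 e1 e2 = (2 : ℂ) • e2 := by
  simp [C08, bil, e1, e2, Fin.sum_univ_two]

theorem C08_e2_e2 : C08 e2 e2 = e2 := by
  simp [C08, bil, e2, Fin.sum_univ_two]

theorem V2_eq_smul_e1_add_smul_e2 (x : V2) : x = x 0 • e1 + x 1 • e2 := by
  ext i
  fin_cases i <;> simp [e1, e2]

/-- A linear map fixing `e2` and sending `e1` to `a e1 + b e2` preserves `C08`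
as soon as it satisfies `2 a + b = 2` and `b (1 + a) = 0`. -/
theorem map_C08_of_apply_basis (φ : V2 ≃ₗ[ℂ] V2) {a b : ℂ}
    (h₁ : φ e1 = a • e1 + b • e2) (h₂ : φ e2 = e2)
    (hab : 2 * a + b = 2) (hb : b * (1 + a) = 0) (x y : V2) :
    φ (C08 x y) = C08 (φ x) (φ y) := by
  have hφ (z : V2) : φ z = (z 0 * a) • e1 + (z 0 * b + z 1) • e2 := by
    conv_lhs => rw [V2_eq_smul_e1_add_smul_e2 z]
    rw [map_add, map_smul, map_smul, h₁, h₂]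
    module
  have hφ0 (z : V2) : φ z 0 = z 0 * a := by simp [hφ z, e1, e2]
  have hφ1 (z : V2) : φ z 1 = z 0 * b + z 1 := by simp [hφ z, e1, e2]
  ext i
  fin_cases i
  · change φ (C08 x y) 0 = C08 (φ x) (φ y) 0
    rw [C08_apply_zero, hφ0, hφ0, hφ0, hφ1, C08_apply_zero]
    linear_combination (-(x 0 * y 0 * a / 2)) * hab
  · change φ (C08 x y) 1 = C08 (φ x) (φ y) 1
    rw [C08_apply_one, hφ1, hφ0, hφ0, hφ1, hφ1, C08_apply_zero, C08_apply_one]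
    linear_combination (-(x 0 * y 0 * b + x 0 * y 1)) * hab + (-(x 0 * y 0)) * hb -
      x 1 * y 0 / 2 * hab

/-- The automorphisms of the pre-Lie algebra `C08`
(`e1·e1 = e1, e1·e2 = 2 e2, e2·e1 = (1/2) e1 + e2, e2·e2 = e2`) are exactly the
identity and the map `e1 ↦ −e1 + 4 e2, e2 ↦ e2`. -/
theorem automorphisms_of_C08 (φ : V2 ≃ₗ[ℂ] V2) :
    (∀ x y : V2, φ (C08 x y) = C08 (φ x) (φ y)) ↔
      ((φ e1 = e1 ∧ φ e2 = e2) ∨ (φ e1 = -e1 + (4 : ℂ) • e2 ∧ φ e2 = e2)) := by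
  constructor
  · intro h
    have h11 := h e1 e1
    have h12 := h e1 e2
    have h22 := h e2 e2
    rw [C08_e1_e1] at h11
    rw [C08_e1_e2, map_smul] at h12
    rw [C08_e2_e2] at h22
    have h110 := congrFun h11 0
    have h111 := congrFun h11 1
    have h120 := congrFun h12 0
    have h121 := congrFun h12 1
    have h221 := congrFun h22 1
    rw [C08_apply_zero] at h110 h120
    rw [C08_apply_one] at h111 h121 h221
    simp only [Pi.smul_apply, smul_eq_mul] at h120 h121
    have hc : φ e2 0 = 0 := by
      by_contra hc
      have hab : φ e1 0 + φ e1 1 / 2 = 2 := (mul_right_cancel₀ hc h120).symm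
      rw [hab] at h110
      have ha : φ e1 0 = 0 := by linear_combination -h110
      have hb : φ e1 1 = 4 := by linear_combination 2 * hab - 2 * ha
      rw [ha, hb] at h111
      norm_num at h111
    have hd0 : φ e2 1 ≠ 0 := by
      intro hd
      have hφ : φ e2 = 0 := by
        rw [V2_eq_smul_e1_add_smul_e2 (φ e2), hc, hd, zero_smul, zero_smul, add_zero]
      have he : e2 = 0 := φ.map_eq_zero_iff.mp hφ
      simpa [e2] using congrFun he 1
    have hd : φ e2 1 = 1 := by
      apply mul_right_cancel₀ hd0
      rw [hc] at h221
      linear_combination -h221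
    have h2 : φ e2 = e2 := by
      rw [V2_eq_smul_e1_add_smul_e2 (φ e2), hc, hd, zero_smul, one_smul, zero_add]
    rw [hc, hd] at h121
    have hb : φ e1 1 * (1 + φ e1 0) = 0 := by
      linear_combination φ e1 1 * h121 - h111
    rcases mul_eq_zero.mp hb with hb | ha
    · have ha : φ e1 0 = 1 := by linear_combination -h121 / 2 - hb / 2
      refine Or.inl ⟨?_, h2⟩
      rw [V2_eq_smul_e1_add_smul_e2 (φ e1), ha, hb, one_smul, zero_smul, add_zero]
    · have ha : φ e1 0 = -1 := by linear_combination ha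
      have hb : φ e1 1 = 4 := by linear_combination -h121 - 2 * ha
      refine Or.inr ⟨?_, h2⟩
      rw [V2_eq_smul_e1_add_smul_e2 (φ e1), ha, hb, neg_one_smul]
  · rintro (⟨h₁, h₂⟩ | ⟨h₁, h₂⟩)
    · exact map_C08_of_apply_basis φ (a := 1) (b := 0) (by simpa using h₁) h₂
        (by norm_num) (by norm_num)
    · exact map_C08_of_apply_basis φ (a := -1) (b := 4) (by simpa using h₁) h₂
        (by norm_num) (by norm_num)
end

section
/- Let μ be the pre-Lie multiplication on ℂ² given by e1·e1 = e1 + e2, e1·e2 = e2 (algebra C02), and let ν be any bilinear map on ℂ² such that (ℂ², μ, ν) is a compatible pre-Lie algebra. Then (ℂ², μ, ν) is isomorphic as a compatible pre-Lie algebra to one of: C11^{α,β} (α,β ∈ ℂ, β ≠ α) with first multiplication μ and second multiplication e1∗e1 = α e1, e1∗e2 = β e2; or C12^{α,β} (α,β ∈ ℂ) with first multiplication μ and second multiplication e1∗e1 = α e1 + β e2, e1∗e2 = α e2. -/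
open scoped BigOperators

theorem bil_apply (f : Fin 2 → Fin 2 → V2) (x y : V2) (k : Fin 2) :
    bil f x y k = x 0 * y 0 * f 0 0 k + x 0 * y 1 * f 0 1 k +
      (x 1 * y 0 * f 1 0 k + x 1 * y 1 * f 1 1 k) := by
  simp [bil, Fin.sum_univ_two]

/-- Every bilinear multiplication on `ℂ²` is given by its multiplication table. -/
theorem eq_bil_table (ν : V2 →ₗ[ℂ] V2 →ₗ[ℂ] V2) :
    ν = bil ![![ν e1 e1, ν e1 e2], ![ν e2 e1, ν e2 e2]] := by
  have basis (x : V2) : x = x 0 • e1 + x 1 • e2 := by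
    ext k; fin_cases k <;> simp [e1, e2]
  refine LinearMap.ext₂ fun x y => ?_
  conv_lhs => rw [basis x, basis y]
  ext k
  rw [bil_apply]
  simp only [map_add, map_smul, LinearMap.add_apply, LinearMap.smul_apply, Pi.add_apply,
    Pi.smul_apply, smul_eq_mul, Matrix.cons_val_zero, Matrix.cons_val_one]
  ring

/-- A multiplication compatible with `C02` has a table of the form
`e1∗e1 = a e1 + b e2, e1∗e2 = d e2`. -/
theorem exists_eq_bil_of_isCompatPreLie_C02 {ν : V2 →ₗ[ℂ] V2 →ₗ[ℂ] V2}
    (h : IsCompatPreLie C02 ν) :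
    ∃ a b d : ℂ, ν = bil ![![a • e1 + b • e2, d • e2], ![0, 0]] := by
  obtain ⟨hμ, hν, hs⟩ := h
  have mixed (z : V2) (k : Fin 2) :
      ν (C02 e1 e2) z k + C02 (ν e1 e2) z k - ν e1 (C02 e2 z) k - C02 e1 (ν e2 z) k =
      ν (C02 e2 e1) z k + C02 (ν e2 e1) z k - ν e2 (C02 e1 z) k - C02 e2 (ν e1 z) k := by
    have h1 := congrFun (hμ e1 e2 z) k
    have h2 := congrFun (hν e1 e2 z) k
    have h3 := congrFun (hs e1 e2 z) k
    simp only [LinearMap.add_apply, map_add, Pi.add_apply, Pi.sub_apply] at h1 h2 h3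
    linear_combination h3 - h1 - h2
  obtain ⟨f, rfl⟩ : ∃ f, ν = bil f := ⟨_, eq_bil_table ν⟩
  have m11 := mixed e1 0
  have m12 := mixed e1 1
  have m21 := mixed e2 0
  have m22 := mixed e2 1
  have n11 := congrFun (hν e1 e2 e1) 0
  have n22 := congrFun (hν e1 e2 e2) 1
  simp [C02, bil_apply, e1, e2] at m11 m12 m21 m22 n11 n22
  have hr : f 1 1 0 = 0 := by linear_combination m21
  have hc : f 0 1 0 = 0 := by linear_combination m11 - hr
  have hs : f 1 1 1 = f 1 0 0 := by linear_combination m22 + hr - hc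
  have hq : f 1 0 1 = f 1 0 0 := by linear_combination m12 - hc - hs
  have hp : f 1 0 0 = 0 := by
    rw [← pow_eq_zero_iff two_ne_zero]
    simp only [hr, hc, hs, hq] at n22
    linear_combination -n22
  refine ⟨f 0 0 0, f 0 0 1, f 0 1 1, LinearMap.ext₂ fun x y => ?_⟩
  ext k
  fin_cases k <;> simp [bil_apply, e1, e2, hr, hc, hs, hq, hp]

/-- The shear `e1 ↦ e1 + t e2, e2 ↦ e2` of `ℂ²`. -/
def shear (t : ℂ) : V2 ≃ₗ[ℂ] V2 where
  toFun x := ![x 0, x 1 + t * x 0]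
  invFun x := ![x 0, x 1 - t * x 0]
  map_add' x y := by
    ext k; fin_cases k <;> simp; ring
  map_smul' c x := by
    ext k; fin_cases k <;> simp; ring
  left_inv x := by
    ext k; fin_cases k <;> simp
  right_inv x := by
    ext k; fin_cases k <;> simp

/-- Shears are automorphisms of `C02`, and act on compatible multiplications by
`b ↦ b + t (a - d)`. -/
theorem compatIso_shear (a b d t : ℂ) :
    CompatIso C02 (bil ![![a • e1 + b • e2, d • e2], ![0, 0]])
      C02 (bil ![![a • e1 + (b + t * (a - d)) • e2, d • e2], ![0, 0]]) := by
  refine ⟨shear t, fun x y => ?_, fun x y => ?_⟩ <;> ext k <;> fin_cases k <;>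
    simp [shear, C02, bil_apply, e1, e2] <;> ring

/-- Every compatible pre-Lie algebra whose first multiplication is `C02`
(`e1·e1 = e1 + e2, e1·e2 = e2`) is isomorphic to some `C11^{α,β}` (`β ≠ α`) or
some `C12^{α,β}`. -/
theorem compatible_preLie_on_C02 (ν : V2 →ₗ[ℂ] V2 →ₗ[ℂ] V2)
    (h : IsCompatPreLie C02 ν) :
    (∃ α β : ℂ, β ≠ α ∧ CompatIso C02 ν C02 (C11s α β)) ∨
      (∃ α β : ℂ, CompatIso C02 ν C02 (C12s α β)) := by
  obtain ⟨a, b, d, rfl⟩ := exists_eq_bil_of_isCompatPreLie_C02 h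
  by_cases hda : d = a
  · subst hda
    exact .inr ⟨d, b, .refl ℂ V2, fun _ _ => rfl, fun _ _ => rfl⟩
  · refine .inl ⟨a, d, hda, ?_⟩
    have hsub : d - a ≠ 0 := sub_ne_zero.mpr hda
    have hb : b + b / (d - a) * (a - d) = 0 := by
      field_simp
      ring
    simpa [hb, C11s] using compatIso_shear a b d (b / (d - a))
end
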